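/- (Core step of Theorem 1: the local test on (2Δ+1)-tuples certifies a parent set.) Let Ω = Ω_1 × ⋯ × Ω_n be a product of nonempty finite sets and P a strictly positive probability measure on Ω that is Markov relative to some DAG G consistent with the ordering and of in-degree at most Δ. Fix j ∈ {1,…,n} and set m := min(j−1, Δ). Suppose K ⊆ {1,…,j−1} with |K| = m is such that for every L ⊆ {1,…,j−1} \ K with |L| ≤ m one has (X_j ⊥ {X_i : i ∈ L} | {X_i : i ∈ K}). Then (X_j ⊥ {X_i : i ∈ {1,…,j−1} \ K} | {X_i : i ∈ K}), i.e., K renders X_j independent of all its other predecessors. -/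

import Mathlib

/-- The marginal probability, under a finitely supported distribution `P` on the
product `Ω = Ω_1 × ⋯ × Ω_n`, of the event that all coordinates in `J` take the
values prescribed by `x`. -/
def marg {n : ℕ} {Ω : Fin n → Type*} [∀ i, Fintype (Ω i)] [∀ i, DecidableEq (Ω i)]
    (P : (∀ i, Ω i) → ℝ) (J : Finset (Fin n)) (x : ∀ i, Ω i) : ℝ :=
  ∑ y : ∀ i, Ω i, if ∀ i ∈ J, y i = x i then P y else 0

/-- `P` is Markov relative to the DAG with parent sets `Pa`: for every point `x`,
`P(x) = ∏_j P(x_j | pa_j)`, written in cross-multiplied form. -/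
def IsMarkov {n : ℕ} {Ω : Fin n → Type*} [∀ i, Fintype (Ω i)] [∀ i, DecidableEq (Ω i)]
    (P : (∀ i, Ω i) → ℝ) (Pa : Fin n → Finset (Fin n)) : Prop :=
  ∀ x : ∀ i, Ω i,
    P x * ∏ j, marg P (Pa j) x = ∏ j, marg P (insert j (Pa j)) x

/-- Conditional independence `(X_A ⊥ X_B | X_C)` of the coordinate variables in `A`
from those in `B` given those in `C`, in cross-multiplied form
`P(a,b,c)·P(c) = P(a,c)·P(b,c)` for all value assignments (for strictly positive `P`
this is equivalent to `P(a,b|c) = P(a|c)·P(b|c)` whenever `P(c) > 0`). -/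
def CondIndep {n : ℕ} {Ω : Fin n → Type*} [∀ i, Fintype (Ω i)] [∀ i, DecidableEq (Ω i)]
    (P : (∀ i, Ω i) → ℝ) (A B C : Finset (Fin n)) : Prop :=
  ∀ x : ∀ i, Ω i,
    marg P (A ∪ B ∪ C) x * marg P C x = marg P (A ∪ C) x * marg P (B ∪ C) x

section Marginals

variable {n : ℕ} {Ω : Fin n → Type*} [∀ i, Fintype (Ω i)] [∀ i, DecidableEq (Ω i)]

theorem marg_congr (P : (∀ i, Ω i) → ℝ) {J : Finset (Fin n)} {x y : ∀ i, Ω i}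
    (h : ∀ i ∈ J, x i = y i) : marg P J x = marg P J y := by
  unfold marg
  refine Finset.sum_congr rfl fun z _ => if_congr ?_ rfl rfl
  exact forall₂_congr fun i hi => by rw [h i hi]

theorem marg_update (P : (∀ i, Ω i) → ℝ) {J : Finset (Fin n)} {k : Fin n} (hk : k ∉ J)
    (x : ∀ i, Ω i) (a : Ω k) : marg P J (Function.update x k a) = marg P J x :=
  marg_congr P fun _ hi => Function.update_of_ne (ne_of_mem_of_not_mem hi hk) _ _

theorem marg_pos {P : (∀ i, Ω i) → ℝ} (hP : ∀ x, 0 < P x) (J : Finset (Fin n))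
    (x : ∀ i, Ω i) : 0 < marg P J x := by
  refine Finset.sum_pos' (fun y _ => ?_) ⟨x, Finset.mem_univ _, by simp [hP x]⟩
  split_ifs
  exacts [(hP y).le, le_rfl]

theorem marg_univ (P : (∀ i, Ω i) → ℝ) (x : ∀ i, Ω i) : marg P Finset.univ x = P x := by
  simp [marg, ← funext_iff]

/-- Summing out a coordinate. -/
theorem sum_marg_insert_update (P : (∀ i, Ω i) → ℝ) {J : Finset (Fin n)} {k : Fin n}
    (hk : k ∉ J) (x : ∀ i, Ω i) :
    ∑ a, marg P (insert k J) (Function.update x k a) = marg P J x := by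
  unfold marg
  rw [Finset.sum_comm]
  refine Finset.sum_congr rfl fun y _ => ?_
  have h (a : Ω k) : (∀ i ∈ insert k J, y i = Function.update x k a i) ↔
      y k = a ∧ ∀ i ∈ J, y i = x i := by
    rw [Finset.forall_mem_insert, Function.update_self]
    refine and_congr_right fun _ => forall₂_congr fun i hi => ?_
    rw [Function.update_of_ne (ne_of_mem_of_not_mem hi hk)]
  simp only [h, ite_and, Finset.sum_ite_eq, Finset.mem_univ, if_true]

/-- If `P(x_j | x_T) = P(x_j | x_S)`, then `P(x_j | x_M) = P(x_j | x_S)` for `S ⊆ M ⊆ T`. -/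
theorem marg_insert_mul_marg_of_subset (P : (∀ i, Ω i) → ℝ) {j : Fin n}
    {S M T : Finset (Fin n)} (hSM : S ⊆ M) (hMT : M ⊆ T) (hj : j ∉ T)
    (h : ∀ x, marg P (insert j T) x * marg P S x = marg P T x * marg P (insert j S) x)
    (x : ∀ i, Ω i) :
    marg P (insert j M) x * marg P S x = marg P M x * marg P (insert j S) x := by
  obtain ⟨D, rfl⟩ : ∃ D, T = D ∪ M := ⟨T, (Finset.union_eq_left.2 hMT).symm⟩
  clear hMT
  induction D using Finset.induction_on generalizing x with
  | empty => simpa using h x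
  | insert k D _ ih =>
    rw [Finset.insert_union, Finset.mem_insert, not_or] at hj
    refine ih x hj.2 fun x => ?_
    by_cases hk : k ∈ D ∪ M
    · simpa [Finset.insert_union, Finset.insert_eq_of_mem hk] using h x
    have hkS : k ∉ S := fun hS => hk (Finset.mem_union_right _ (hSM hS))
    have hkj : k ≠ j := Ne.symm hj.1
    rw [← sum_marg_insert_update P hk, ← sum_marg_insert_update P (k := k)
      (J := insert j (D ∪ M)) (by simp [hkj, hk]), Finset.sum_mul, Finset.sum_mul]
    refine Finset.sum_congr rfl fun a _ => ?_
    have := h (Function.update x k a)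
    rwa [marg_update P hkS, marg_update P (J := insert j S) (by simp [hkj, hkS]),
      Finset.insert_union, Finset.insert_comm] at this

/-- Initial segments of a Markov distribution factorize. -/
theorem IsMarkov.marg_initial_eq_prod {P : (∀ i, Ω i) → ℝ} {Pa : Fin n → Finset (Fin n)}
    (hM : IsMarkov P Pa) (hP : ∀ x, 0 < P x) (horder : ∀ j, ∀ i ∈ Pa j, i < j)
    {m : ℕ} (hm : m ≤ n) (x : ∀ i, Ω i) :
    marg P (Finset.univ.filter fun i => i.val < m) x =
      ∏ i with i.val < m, marg P (insert i (Pa i)) x / marg P (Pa i) x := by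
  induction hm using Nat.decreasingInduction generalizing x with
  | self =>
    have h : (Finset.univ.filter fun i : Fin n => i.val < n) = Finset.univ := by simp
    rw [h, marg_univ, Finset.prod_div_distrib, eq_div_iff, hM x]
    exact Finset.prod_ne_zero_iff.2 fun i _ => (marg_pos hP _ x).ne'
  | of_succ m hm ih =>
    let k : Fin n := ⟨m, hm⟩
    have hins : (Finset.univ.filter fun i : Fin n => i.val < m + 1) =
        insert k (Finset.univ.filter fun i => i.val < m) := by
      ext i
      simp [k, Fin.ext_iff]
      omega
    have hk : k ∉ Finset.univ.filter fun i : Fin n => i.val < m := by simp [k]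
    have hkPa : k ∉ Pa k := fun h => lt_irrefl _ (horder k k h)
    rw [hins] at ih
    simp_rw [← sum_marg_insert_update P hk x, ih, Finset.prod_insert hk, marg_update P hkPa]
    have hprod (a : Ω k) : (∏ i with i.val < m,
        marg P (insert i (Pa i)) (Function.update x k a) /
          marg P (Pa i) (Function.update x k a)) =
        ∏ i with i.val < m, marg P (insert i (Pa i)) x / marg P (Pa i) x := by
      refine Finset.prod_congr rfl fun i hi => ?_
      have hik : i < k := (Finset.mem_filter.1 hi).2
      have hki : k ∉ Pa i := fun h => lt_asymm hik (horder i k h)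
      rw [marg_update P hki, marg_update P (by simp [hki, hik.ne'])]
    simp_rw [hprod]
    rw [← Finset.sum_mul, ← Finset.sum_div, sum_marg_insert_update P hkPa,
      div_self (marg_pos hP _ x).ne', one_mul]

/-- The local Markov property: `P(x_j | x_1, …, x_{j-1}) = P(x_j | pa_j)`. -/
theorem IsMarkov.marg_insert_Iio_mul {P : (∀ i, Ω i) → ℝ} {Pa : Fin n → Finset (Fin n)}
    (hM : IsMarkov P Pa) (hP : ∀ x, 0 < P x) (horder : ∀ j, ∀ i ∈ Pa j, i < j)
    (j : Fin n) (x : ∀ i, Ω i) :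
    marg P (insert j (Finset.Iio j)) x * marg P (Pa j) x =
      marg P (Finset.Iio j) x * marg P (insert j (Pa j)) x := by
  have hIio : (Finset.univ.filter fun i : Fin n => i.val < j.val) = Finset.Iio j := by
    ext i
    simp
  have hins : (Finset.univ.filter fun i : Fin n => i.val < j.val + 1) =
      insert j (Finset.Iio j) := by
    ext i
    simp
  have h₁ := hM.marg_initial_eq_prod hP horder j.isLt.le x
  have h₂ := hM.marg_initial_eq_prod hP horder (Nat.succ_le_of_lt j.isLt) x
  rw [hIio] at h₁
  rw [Nat.succ_eq_add_one, hins, Finset.prod_insert (by simp), ← h₁] at h₂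
  have := (marg_pos hP (Pa j) x).ne'
  rw [h₂]
  field_simp

end Marginals

/-- **core step of Theorem 1.** Let the strictly positive `P` be
Markov relative to some ordering-consistent DAG of in-degree at most `Δ`.  Fix `j`,
put `m := min (j-1) Δ` (in `Fin n` indexing, `j` has `j.val` predecessors), and let
`K` be an `m`-subset of the predecessors of `j` such that `(X_j ⊥ L | K)` holds for
every set `L` of at most `m` predecessors disjoint from `K`.  Then `K` renders `X_j`
independent of all its other predecessors. -/
theorem local_test_certifies_parents
    {n Δ : ℕ} {Ω : Fin n → Type*} [∀ i, Fintype (Ω i)] [∀ i, Nonempty (Ω i)]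
    [∀ i, DecidableEq (Ω i)]
    (Pa : Fin n → Finset (Fin n))
    (horder : ∀ j : Fin n, ∀ i ∈ Pa j, i < j)
    (hdeg : ∀ j : Fin n, (Pa j).card ≤ Δ)
    (P : (∀ i, Ω i) → ℝ)
    (hPpos : ∀ x, 0 < P x) (hPsum : ∑ x, P x = 1)
    (hPMarkov : IsMarkov P Pa)
    (j : Fin n) (K : Finset (Fin n))
    (hKpred : K ⊆ Finset.Iio j) (hKcard : K.card = min j.val Δ)
    (htest : ∀ L ⊆ Finset.Iio j \ K, L.card ≤ min j.val Δ → CondIndep P {j} L K) :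
    CondIndep P {j} (Finset.Iio j \ K) K := by
  have hPa : Pa j ⊆ Finset.Iio j := fun i hi => Finset.mem_Iio.2 (horder j i hi)
  have hcard : (Pa j \ K).card ≤ min j.val Δ :=
    (Finset.card_le_card Finset.sdiff_subset).trans
      (le_min (by simpa using Finset.card_le_card hPa) (hdeg j))
  have hlocal := hPMarkov.marg_insert_Iio_mul hPpos horder j
  intro x
  have hA := hlocal x
  have hB := marg_insert_mul_marg_of_subset P (M := Pa j ∪ K) Finset.subset_union_left
    (Finset.union_subset hPa hKpred) (by simp) hlocal x
  have hC := htest (Pa j \ K) (Finset.sdiff_subset_sdiff hPa subset_rfl) hcard x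
  rw [Finset.union_assoc, Finset.sdiff_union_self_eq_union, ← Finset.insert_eq,
    ← Finset.insert_eq] at hC
  rw [Finset.union_assoc, Finset.sdiff_union_of_subset hKpred, ← Finset.insert_eq,
    ← Finset.insert_eq]
  have hS := (marg_pos hPpos (Pa j) x).ne'
  have hSK := (marg_pos hPpos (Pa j ∪ K) x).ne'
  refine mul_right_cancel₀ (mul_ne_zero hS hSK) ?_
  linear_combination marg P K x * marg P (Pa j ∪ K) x * hA -
    marg P (Finset.Iio j) x * marg P K x * hB +
    marg P (Finset.Iio j) x * marg P (Pa j) x * hC
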